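/- Let F' be a subgroup of finite index e in a free group F of finite rank r. Then F' is free of finite rank r' and e(r-1) = r'-1. -/

import Mathlib

open CategoryTheory

universe u v

/-- After choosing a morphism from a base point `c` to every object, a functor from a connected
groupoid to a group is determined by its restriction to the vertex group at `c` and by its values
on the chosen morphisms, and these data can be prescribed freely. -/
noncomputable def functorEquivEndHomProd {C : Type*} [Groupoid C] [IsConnected C] (c : C)
    (X : Type*) [Group X] :
    (C ⥤ SingleObj X) ≃ (End c →* X) × ({a : C // a ≠ c} → X) := by
  classical
  let t : ∀ a : C, c ⟶ a := fun a =>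
    if h : a = c then eqToHom h.symm else (nonempty_hom_of_preconnected_groupoid c a).some
  have t_self : t c = 𝟙 c := by simp [t]
  let ext : ({a : C // a ≠ c} → X) → C → X := fun f a => if h : a = c then 1 else f ⟨a, h⟩
  have ext_self : ∀ f, ext f c = 1 := fun f => by simp [ext]
  let loop : ∀ {a b : C}, (a ⟶ b) → End c := fun {a b} p => t a ≫ p ≫ inv (t b)
  have loop_id : ∀ a : C, loop (𝟙 a) = 1 := fun a => by simp [loop, End.one_def]
  have loop_comp : ∀ {a b d : C} (p : a ⟶ b) (q : b ⟶ d), loop (p ≫ q) = loop q * loop p :=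
    fun p q => by simp [loop, End.mul_def]
  have loop_self : ∀ p : End c, loop p = p := fun p => by simp [loop, t_self]
  have loop_t : ∀ a : C, loop (t a) = 1 := fun a => by simp [loop, t_self, End.one_def]
  exact
    { toFun := fun F =>
        ({ toFun := fun p => F.map p
           map_one' := F.map_id c
           map_mul' := fun p q => F.map_comp q p },
          fun a => F.map (t a))
      invFun := fun φf =>
        { obj := fun _ => SingleObj.star X
          map := fun {a b} p => (ext φf.2 b * φf.1 (loop p) * (ext φf.2 a)⁻¹ : X)
          map_id := fun a => by
            rw [loop_id, map_one, mul_one, mul_inv_cancel, SingleObj.id_as_one]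
          map_comp := fun p q => by
            rw [loop_comp, map_mul, SingleObj.comp_as_mul]
            group }
      left_inv := fun F => by
        let f' : C → X := fun a => F.map (t a)
        let f : {a : C // a ≠ c} → X := fun a => f' a
        have ext_f : ∀ a : C, ext f a = f' a := by
          intro a
          by_cases h : a = c
          · subst h
            rw [ext_self]
            simp only [f', t_self, F.map_id, SingleObj.id_as_one]
          · exact dif_neg h
        refine Functor.hext (fun _ => rfl) fun a b p => heq_of_eq ?_
        change (ext f b * F.map (t a ≫ p ≫ inv (t b)) *
          (ext f a)⁻¹ : X) = F.map p
        rw [ext_f, ext_f, F.map_comp, F.map_comp, F.map_inv, SingleObj.comp_as_mul,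
          SingleObj.comp_as_mul, SingleObj.inv_as_inv]
        change (f' b * ((f' b)⁻¹ * F.map p * f' a) * (f' a)⁻¹ : X) = F.map p
        group
      right_inv := fun ⟨φ, f⟩ => by
        refine Prod.ext (MonoidHom.ext fun p => ?_) (funext fun a => ?_)
        · change ext f c * φ (loop p) * (ext f c)⁻¹ = φ p
          rw [ext_self, loop_self, one_mul, inv_one, mul_one]
        · change ext f a * φ (loop (t a)) * (ext f c)⁻¹ = f a
          rw [ext_self, loop_t, map_one, mul_one, inv_one, mul_one]
          exact dif_neg a.2 }

/-- Functors from a free groupoid to a group correspond to labellings of the generators. -/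
noncomputable def IsFreeGroupoid.functorEquivLabelling {C : Type*} [Groupoid.{v} C]
    [IsFreeGroupoid C] (X : Type v) [Group X] :
    (C ⥤ SingleObj X) ≃ Quiver.Labelling (IsFreeGroupoid.Generators C) X :=
  Equiv.ofBijective (fun F _ _ g => F.map (IsFreeGroupoid.of g))
    ⟨fun F F' h => IsFreeGroupoid.ext_functor F F' fun a b g =>
        congrFun (congrFun (congrFun h a) b) g,
      fun f => (IsFreeGroupoid.unique_lift f).exists.imp fun F hF => by
        funext a b g
        exact hF a b g⟩

/-- An arrow of the generating quiver of the action groupoid of a free group is determined by its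
source and a generator of the group. -/
noncomputable def labellingActionCategoryEquiv (G A : Type u) [Group G] [IsFreeGroup G] [MulAction G A]
    (X : Type*) :
    Quiver.Labelling (IsFreeGroupoid.Generators (ActionCategory G A)) X ≃
      (A × IsFreeGroup.Generators G → X) where
  toFun f p := @f ⟨(), p.1⟩ ⟨(), IsFreeGroup.of p.2 • p.1⟩ ⟨p.2, rfl⟩
  invFun f a _ g := f (a.2, g.1)
  left_inv f := by
    funext a b g
    obtain ⟨⟨⟩, a : A⟩ := a
    obtain ⟨⟨⟩, b : A⟩ := b
    obtain ⟨g, hg : IsFreeGroup.of g • a = b⟩ := g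
    subst hg
    rfl
  right_inv _ := rfl

/-- For a subgroup `H` of a free group `G`, functors from the action groupoid of `G ⧸ H` to a group
`X` are counted in two ways: by their restriction to the vertex group `H`, and by their values on
the generating arrows. -/
theorem IsFreeGroup.card_hom_mul_card_fun_eq {G : Type u} [Group G] [IsFreeGroup G]
    (H : Subgroup G) (X : Type u) [Group X] :
    Nat.card (IsFreeGroup.Generators H → X) *
        Nat.card ({a : G ⧸ H // a ≠ (1 : G)} → X) =
      Nat.card ((G ⧸ H) × IsFreeGroup.Generators G → X) := by
  let c : ActionCategory G (G ⧸ H) := ActionCategory.objEquiv G (G ⧸ H) (1 : G)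
  have homEquiv : (IsFreeGroup.Generators H → X) ≃ (End c →* X) :=
    IsFreeGroup.lift.trans
      (ActionCategory.endMulEquivSubgroup H).symm.monoidHomCongrLeftEquiv
  have funEquiv : ({a : G ⧸ H // a ≠ (1 : G)} → X) ≃ ({a // a ≠ c} → X) :=
    ((ActionCategory.objEquiv G (G ⧸ H)).subtypeEquiv fun _ =>
      (ActionCategory.objEquiv G (G ⧸ H)).apply_eq_iff_eq.not.symm).arrowCongr (.refl X)
  have connected : IsConnected (ActionCategory G (G ⧸ H)) := inferInstance
  have : @IsConnected (ActionCategory G (G ⧸ H)) Groupoid.toCategory := connected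
  rw [← Nat.card_prod]
  exact Nat.card_congr <| (homEquiv.prodCongr funEquiv).trans <|
    (functorEquivEndHomProd c X).symm.trans <|
    (IsFreeGroupoid.functorEquivLabelling X).trans <|
    labellingActionCategoryEquiv G (G ⧸ H) X

/-- Nielsen–Schreier index formula: a subgroup `H` of finite index `e` in a free
group of finite rank `r` is free of some finite rank `r'` with `e(r-1) = r'-1`. -/
theorem stmt_3 (r : ℕ) (H : Subgroup (FreeGroup (Fin r))) (e : ℕ)
    (he : H.index = e) (he0 : e ≠ 0) :
    ∃ r' : ℕ, Nonempty (H ≃* FreeGroup (Fin r')) ∧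
      (e : ℤ) * ((r : ℤ) - 1) = (r' : ℤ) - 1 := by
  let G := FreeGroup (Fin r)
  have : H.FiniteIndex := ⟨he.symm ▸ he0⟩
  have genEquiv : IsFreeGroup.Generators G ≃ Fin r :=
    Equiv.ofFreeGroupEquiv (IsFreeGroup.toFreeGroup G).symm
  have : Finite (IsFreeGroup.Generators G) := .of_equiv _ genEquiv.symm
  have key := IsFreeGroup.card_hom_mul_card_fun_eq H (Multiplicative (ZMod 2))
  have cardX : Nat.card (Multiplicative (ZMod 2)) = 2 := Nat.card_zmod 2
  have cardA : Nat.card (G ⧸ H) = e := he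
  have cardA' : Nat.card {a : G ⧸ H // a ≠ (1 : G)} + 1 = e := by
    rw [← cardA, ← Finite.card_option]
    classical
    exact Nat.card_congr (Equiv.optionSubtypeNe _)
  have : Finite (IsFreeGroup.Generators H) := by
    by_contra hK
    rw [not_finite_iff_infinite] at hK
    have : Nontrivial (Multiplicative (ZMod 2)) := inferInstanceAs (Nontrivial (ZMod 2))
    rw [Nat.card_eq_zero_of_infinite (α := IsFreeGroup.Generators H → _), zero_mul] at key
    exact Nat.card_pos.ne key
  rw [Nat.card_fun, Nat.card_fun, Nat.card_fun, cardX, ← pow_add, Nat.card_prod, cardA,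
    Nat.card_congr genEquiv, Nat.card_fin] at key
  have hexp := Nat.pow_right_injective le_rfl key
  refine ⟨Nat.card (IsFreeGroup.Generators H),
    ⟨(IsFreeGroup.toFreeGroup H).trans (FreeGroup.freeGroupCongr (Finite.equivFin _))⟩, ?_⟩
  zify at hexp cardA'
  linarith
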